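/- Under the carry-sequence setup, if c_i = 5 and c_{i−1} = 4 for some index i, then c_{i−2} ≤ 4. -/

import Mathlib

/-- In the carry-sequence setup, if `c_i = 5` and `c_{i−1} = 4` then `c_{i−2} ≤ 4`. -/
theorem carry_five_four_then_le_four
    (m : ℕ) (hm : 0 < m)
    (a b c : ℤ → ℤ)
    (ha : ∀ i, 0 ≤ a i ∧ a i ≤ 2) (hap : ∀ i, a (i + (m : ℤ)) = a i)
    (hb : ∀ i, 0 ≤ b i ∧ b i ≤ 2) (hbp : ∀ i, b (i + (m : ℤ)) = b i)
    (hc : ∀ i, 0 ≤ c i ∧ c i ≤ 6) (hcp : ∀ i, c (i + (m : ℤ)) = c i)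
    (hs : ∀ i, 0 ≤ (9 - 2 * a (i - 1) + a i - b (i - 2) + b (i - 1) - b i) - 3 * c i + c (i - 1) ∧
      (9 - 2 * a (i - 1) + a i - b (i - 2) + b (i - 1) - b i) - 3 * c i + c (i - 1) ≤ 2) :
    ∀ i, c i = 5 → c (i - 1) = 4 → c (i - 2) ≤ 4 := by
  have six (j : ℤ) (h : c j = 6) : 3 ≤ a j + b (j - 1) - b j := by
    linarith [hs j, hc (j - 1), ha (j - 1), hb (j - 2)]
  have five (j : ℤ) (h : c j = 5) : 1 ≤ a j + b (j - 1) - b j := by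
    have s₀ := hs j
    have c₁ := hc (j - 1)
    have a₁ := ha (j - 1)
    have b₁ := hb (j - 1)
    have b₂ := hb (j - 2)
    have e₁ := six (j - 1)
    rw [show j - 1 - 1 = j - 2 by ring] at e₁
    omega
  intro i h₀ h₁
  by_contra! h₂
  have s₀ := hs i
  have s₁ := hs (i - 1)
  have s₂ := hs (i - 2)
  have five₂ := five (i - 2)
  have six₂ := six (i - 2)
  have five₃ := five (i - 3)
  have six₃ := six (i - 3)
  have a₀ := ha i
  have a₁ := ha (i - 1)
  have a₂ := ha (i - 2)
  have a₃ := ha (i - 3)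
  have b₀ := hb i
  have b₁ := hb (i - 1)
  have b₂ := hb (i - 2)
  have b₃ := hb (i - 3)
  have b₄ := hb (i - 4)
  have c₂ := hc (i - 2)
  have c₃ := hc (i - 3)
  simp only [sub_sub, Int.reduceAdd] at s₀ s₁ s₂ five₂ six₂ five₃ six₃
  grind
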